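/- arXiv:1003.5290 — 5 statements merged into one kernel-verified Lean document; each statement's English description precedes it below -/
import Mathlib

section
/- Suppose p ∈ Q satisfies a(p, v) = ℓ(v) for all v ∈ Q. Then for every q ∈ Q, every y ∈ Y and every g ∈ H such that the residual representation ℓ(v) − ⟨y, Λ v⟩ = ⟨g, T v⟩ holds for all v ∈ Q, one has the guaranteed a posteriori error bound a(p − q, p − q) ≤ ⟨A'(y − A(Λ q)), y − A(Λ q)⟩ + (1/κ)‖g − κ T q‖². The right-hand side is fully computable: it depends only on the approximation q and on the free variables y and g, not on the exact solution p. -/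
open RealInnerProductSpace

/-- Young's inequality in the energy norm of a positive symmetric operator with right inverse. -/
lemma two_mul_inner_le_inner_rightInverse_add {Y : Type*} [NormedAddCommGroup Y]
    [InnerProductSpace ℝ Y] (A A' : Y →L[ℝ] Y) (hsymm : ∀ y z : Y, ⟪A y, z⟫ = ⟪y, A z⟫)
    (hpos : ∀ y : Y, 0 ≤ ⟪A y, y⟫) (hinv : ∀ y : Y, A (A' y) = y) (r e : Y) :
    2 * ⟪r, e⟫ ≤ ⟪A' r, r⟫ + ⟪A e, e⟫ := by
  have h := hpos (A' r - e)
  simp only [map_sub, inner_sub_left, inner_sub_right, hinv] at h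
  rw [hsymm e (A' r), hinv, real_inner_comm (A' r) r, real_inner_comm r e] at h
  linarith [real_inner_comm r e, real_inner_comm (A' r) r]

/-- Young's inequality with a positive weight in a real inner product space. -/
lemma two_mul_inner_le_inv_mul_norm_sq_add {H : Type*} [NormedAddCommGroup H]
    [InnerProductSpace ℝ H] {κ : ℝ} (hκ : 0 < κ) (s t : H) :
    2 * ⟪s, t⟫ ≤ (1 / κ) * ‖s‖ ^ 2 + κ * ⟪t, t⟫ := by
  have h : 0 ≤ (1 / κ) * ‖s - κ • t‖ ^ 2 := by positivity
  rw [norm_sub_sq_real, inner_smul_right, norm_smul, mul_pow, Real.norm_eq_abs, sq_abs] at h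
  rw [real_inner_self_eq_norm_sq]
  have e : (1 / κ) * (‖s‖ ^ 2 - 2 * (κ * ⟪s, t⟫) + κ ^ 2 * ‖t‖ ^ 2)
      = (1 / κ) * ‖s‖ ^ 2 - 2 * ⟪s, t⟫ + κ * ‖t‖ ^ 2 := by
    field_simp
  linarith

theorem guaranteed_a_posteriori_bound_double_diffusion
    {Q Y H : Type*} [NormedAddCommGroup Q] [InnerProductSpace ℝ Q]
    [NormedAddCommGroup Y] [InnerProductSpace ℝ Y]
    [NormedAddCommGroup H] [InnerProductSpace ℝ H]
    (Λ : Q →L[ℝ] Y) (T : Q →L[ℝ] H)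
    (A : Y →L[ℝ] Y) (hAsym : ∀ y z : Y, ⟪A y, z⟫ = ⟪y, A z⟫)
    (α : ℝ) (hα : 0 < α) (hAcoer : ∀ y : Y, α * ‖y‖ ^ 2 ≤ ⟪A y, y⟫)
    (A' : Y →L[ℝ] Y) (hAA' : ∀ y : Y, A (A' y) = y) (hA'A : ∀ y : Y, A' (A y) = y)
    (κ : ℝ) (hκ : 0 < κ)
    (ℓ : Q →L[ℝ] ℝ)
    (a : Q → Q → ℝ)
    (ha : ∀ u v : Q, a u v = ⟪A (Λ u), Λ v⟫ + κ * ⟪T u, T v⟫)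
    (p : Q) (hp : ∀ v : Q, a p v = ℓ v)
    (q : Q) (y : Y) (g : H)
    (hres : ∀ v : Q, ℓ v - ⟪y, Λ v⟫ = ⟪g, T v⟫) :
    a (p - q) (p - q) ≤
      ⟪A' (y - A (Λ q)), y - A (Λ q)⟫ + (1 / κ) * ‖g - κ • T q‖ ^ 2 := by
  have hpos : ∀ z : Y, 0 ≤ ⟪A z, z⟫ := fun z => le_trans (by positivity) (hAcoer z)
  have hY := two_mul_inner_le_inner_rightInverse_add A A' hAsym hpos hAA'
    (y - A (Λ q)) (Λ (p - q))
  have hH := two_mul_inner_le_inv_mul_norm_sq_add hκ (g - κ • T q) (T (p - q))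
  have hid : a (p - q) (p - q) =
      ⟪y - A (Λ q), Λ (p - q)⟫ + ⟪g - κ • T q, T (p - q)⟫ := by
    have hsub : a (p - q) (p - q) = a p (p - q) - a q (p - q) := by
      rw [ha (p - q), ha p, ha q, map_sub Λ p q, map_sub T p q, map_sub A,
        inner_sub_left (A (Λ p)), inner_sub_left (T p)]
      ring
    rw [hsub, hp, ha q, inner_sub_left, inner_sub_left, real_inner_smul_left]
    linarith [hres (p - q)]
  linarith [ha (p - q) (p - q)]
end

section
/- Suppose p ∈ Q satisfies a(p, v) = ℓ(v) for all v ∈ Q. Then the choice y := A(Λ p) and g := κ T p satisfies the residual representation ℓ(v) − ⟨y, Λ v⟩ = ⟨g, T v⟩ for all v ∈ Q, and for every q ∈ Q the majorant becomes exact: ⟨A'(y − A(Λ q)), y − A(Λ q)⟩ + (1/κ)‖g − κ T q‖² = a(p − q, p − q). In particular, the a posteriori error bound has no irremovable gap. -/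
open RealInnerProductSpace

theorem a_posteriori_bound_is_sharp
    {Q Y H : Type*} [NormedAddCommGroup Q] [InnerProductSpace ℝ Q]
    [NormedAddCommGroup Y] [InnerProductSpace ℝ Y]
    [NormedAddCommGroup H] [InnerProductSpace ℝ H]
    (Λ : Q →L[ℝ] Y) (T : Q →L[ℝ] H)
    (A : Y →L[ℝ] Y) (hAsym : ∀ y z : Y, ⟪A y, z⟫ = ⟪y, A z⟫)
    (α : ℝ) (hα : 0 < α) (hAcoer : ∀ y : Y, α * ‖y‖ ^ 2 ≤ ⟪A y, y⟫)
    (A' : Y →L[ℝ] Y) (hAA' : ∀ y : Y, A (A' y) = y) (hA'A : ∀ y : Y, A' (A y) = y)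
    (κ : ℝ) (hκ : 0 < κ)
    (ℓ : Q →L[ℝ] ℝ)
    (a : Q → Q → ℝ)
    (ha : ∀ u v : Q, a u v = ⟪A (Λ u), Λ v⟫ + κ * ⟪T u, T v⟫)
    (p : Q) (hp : ∀ v : Q, a p v = ℓ v) :
    (∀ v : Q, ℓ v - ⟪A (Λ p), Λ v⟫ = ⟪κ • T p, T v⟫) ∧
    (∀ q : Q,
      ⟪A' (A (Λ p) - A (Λ q)), A (Λ p) - A (Λ q)⟫ +
        (1 / κ) * ‖κ • T p - κ • T q‖ ^ 2 = a (p - q) (p - q)) := by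
  refine ⟨fun v => ?_, fun q => ?_⟩
  · rw [← hp v, ha, real_inner_smul_left]
    ring
  · rw [ha, ← map_sub A, ← map_sub Λ, ← smul_sub, ← map_sub T, hA'A, hAsym, norm_smul,
      real_inner_self_eq_norm_sq, mul_pow, Real.norm_eq_abs, sq_abs]
    field_simp
end

section
/- Let ŷ ∈ Y and h, r ∈ H be such that ⟨ŷ, Λ q⟩ = −⟨r, ι q⟩ for all q ∈ Q (r is the 'divergence' of ŷ). Then there exists y ∈ Y satisfying the equilibrium condition ⟨y, Λ q⟩ = −⟨h, ι q⟩ for all q ∈ Q, together with the distance bound ‖y − ŷ‖ ≤ C ‖r − h‖. In particular, the distance from ŷ to the affine set of equilibrated fields { y ∈ Y : ⟨y, Λ q⟩ = −⟨h, ι q⟩ for all q ∈ Q } is at most C ‖r − h‖. -/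
open RealInnerProductSpace

/-- The weak problem `⟪Λ w, Λ q⟫ = ⟪f, q⟫` is solvable when `Λ` is bounded below. -/
theorem exists_inner_map_map_eq_inner {Q Y : Type*}
    [NormedAddCommGroup Q] [InnerProductSpace ℝ Q] [CompleteSpace Q]
    [NormedAddCommGroup Y] [InnerProductSpace ℝ Y]
    (Λ : Q →L[ℝ] Y) {c : ℝ} (hc : 0 < c) (hΛ : ∀ q : Q, c * ‖q‖ ≤ ‖Λ q‖) (f : Q) :
    ∃ w : Q, ∀ q : Q, ⟪Λ w, Λ q⟫ = ⟪f, q⟫ := by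
  let B : Q →L[ℝ] Q →L[ℝ] ℝ := (innerSL ℝ).bilinearComp Λ Λ
  have hB : IsCoercive B := by
    refine ⟨c ^ 2, by positivity, fun q => ?_⟩
    calc c ^ 2 * ‖q‖ * ‖q‖ = (c * ‖q‖) ^ 2 := by ring
      _ ≤ ‖Λ q‖ ^ 2 := by gcongr; exact hΛ q
      _ = B q q := (real_inner_self_eq_norm_sq (Λ q)).symm
  refine ⟨hB.continuousLinearEquivOfBilin.symm f, fun q => ?_⟩
  have hw := hB.continuousLinearEquivOfBilin_apply (hB.continuousLinearEquivOfBilin.symm f) q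
  rw [ContinuousLinearEquiv.apply_symm_apply] at hw
  exact hw.symm

theorem distance_to_equilibrated_fields
    {Q Y H : Type*} [NormedAddCommGroup Q] [InnerProductSpace ℝ Q] [CompleteSpace Q]
    [NormedAddCommGroup Y] [InnerProductSpace ℝ Y] [CompleteSpace Y]
    [NormedAddCommGroup H] [InnerProductSpace ℝ H] [CompleteSpace H]
    (Λ : Q →L[ℝ] Y) (ι : Q →L[ℝ] H)
    (C : ℝ) (hC : 0 < C) (hFriedrichs : ∀ q : Q, ‖ι q‖ ≤ C * ‖Λ q‖)
    (c : ℝ) (hc : 0 < c) (hΛ : ∀ q : Q, c * ‖q‖ ≤ ‖Λ q‖)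
    (yhat : Y) (h r : H)
    (hyhat : ∀ q : Q, ⟪yhat, Λ q⟫ = -⟪r, ι q⟫) :
    ∃ y : Y, (∀ q : Q, ⟪y, Λ q⟫ = -⟪h, ι q⟫) ∧ ‖y - yhat‖ ≤ C * ‖r - h‖ := by
  obtain ⟨w, hw⟩ := exists_inner_map_map_eq_inner Λ hc hΛ (ContinuousLinearMap.adjoint ι (r - h))
  simp only [ContinuousLinearMap.adjoint_inner_left] at hw
  refine ⟨yhat + Λ w, fun q => ?_, ?_⟩
  · rw [inner_add_left, hyhat, hw, inner_sub_left]
    ring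
  · rw [add_sub_cancel_left]
    rcases (norm_nonneg (Λ w)).eq_or_lt with h0 | h0
    · rw [← h0]
      positivity
    · refine le_of_mul_le_mul_right ?_ h0
      calc ‖Λ w‖ * ‖Λ w‖ = ⟪r - h, ι w⟫ := by rw [← real_inner_self_eq_norm_mul_norm, hw]
        _ ≤ ‖r - h‖ * ‖ι w‖ := real_inner_le_norm _ _
        _ ≤ ‖r - h‖ * (C * ‖Λ w‖) := by gcongr; exact hFriedrichs w
        _ = C * ‖r - h‖ * ‖Λ w‖ := by ring
end

section
/- Suppose u ∈ Q satisfies ⟨L(E u), E w⟩ = ⟨f, ι w⟩ for all w ∈ Q. Then for every v ∈ Q, every τ ∈ Y and every r ∈ H such that ⟨τ, E w⟩ = −⟨r, ι w⟩ for all w ∈ Q (r is the 'divergence' of the stress field τ), the a posteriori estimate √⟨L(E(u − v)), E(u − v)⟩ ≤ √⟨L(E v − L' τ), E v − L' τ⟩ + C ‖r + f‖ holds. -/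
open RealInnerProductSpace

/-- Cauchy–Schwarz inequality for the semi-inner product induced by a symmetric nonnegative
operator. -/
theorem abs_inner_apply_le_sqrt_mul_sqrt {Y : Type*} [NormedAddCommGroup Y]
    [InnerProductSpace ℝ Y] (L : Y →L[ℝ] Y) (hsymm : ∀ y z : Y, ⟪L y, z⟫ = ⟪y, L z⟫)
    (hnonneg : ∀ y : Y, 0 ≤ ⟪L y, y⟫) (y z : Y) :
    |⟪L y, z⟫| ≤ √⟪L y, y⟫ * √⟪L z, z⟫ := by
  have hquad (t : ℝ) : 0 ≤ ⟪L y, y⟫ * (t * t) + 2 * ⟪L y, z⟫ * t + ⟪L z, z⟫ := by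
    have h := hnonneg (t • y + z)
    have hzy : ⟪L z, y⟫ = ⟪L y, z⟫ := by rw [hsymm, real_inner_comm]
    simp only [map_add, map_smul, inner_add_left, inner_add_right, real_inner_smul_left,
      real_inner_smul_right, hzy] at h
    linarith
  have hdiscrim := discrim_le_zero hquad
  rw [← Real.sqrt_mul (hnonneg y)]
  apply Real.abs_le_sqrt
  rw [discrim] at hdiscrim
  linarith

theorem elasticity_a_posteriori_estimate
    {Q Y H : Type*} [NormedAddCommGroup Q] [InnerProductSpace ℝ Q]
    [NormedAddCommGroup Y] [InnerProductSpace ℝ Y]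
    [NormedAddCommGroup H] [InnerProductSpace ℝ H]
    (E : Q →L[ℝ] Y) (ι : Q →L[ℝ] H)
    (L : Y →L[ℝ] Y) (hLsym : ∀ y z : Y, ⟪L y, z⟫ = ⟪y, L z⟫)
    (α : ℝ) (hα : 0 < α) (hLcoer : ∀ y : Y, α * ‖y‖ ^ 2 ≤ ⟪L y, y⟫)
    (L' : Y →L[ℝ] Y) (hLL' : ∀ y : Y, L (L' y) = y) (hL'L : ∀ y : Y, L' (L y) = y)
    (C : ℝ) (hC : 0 < C)
    (hKorn : ∀ w : Q, ‖ι w‖ ^ 2 ≤ C ^ 2 * ⟪L (E w), E w⟫)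
    (f : H)
    (u : Q) (hu : ∀ w : Q, ⟪L (E u), E w⟫ = ⟪f, ι w⟫)
    (v : Q) (τ : Y) (r : H)
    (hτ : ∀ w : Q, ⟪τ, E w⟫ = -⟪r, ι w⟫) :
    Real.sqrt ⟪L (E (u - v)), E (u - v)⟫ ≤
      Real.sqrt ⟪L (E v - L' τ), E v - L' τ⟫ + C * ‖r + f‖ := by
  have hnonneg (y : Y) : 0 ≤ ⟪L y, y⟫ := (by positivity : 0 ≤ α * ‖y‖ ^ 2).trans (hLcoer y)
  have hid : ⟪L (E (u - v)), E (u - v)⟫ =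
      ⟪r + f, ι (u - v)⟫ - ⟪L (E v - L' τ), E (u - v)⟫ := by
    have hLu : L (E (u - v)) = L (E u) - L (E v) := by simp only [map_sub]
    rw [hLu, map_sub L (E v), hLL', inner_sub_left, inner_sub_left, hu, hτ, inner_add_left]
    ring
  have hcs := neg_le_of_abs_le
    (abs_inner_apply_le_sqrt_mul_sqrt L hLsym hnonneg (E v - L' τ) (E (u - v)))
  have hι : ‖ι (u - v)‖ ≤ C * √⟪L (E (u - v)), E (u - v)⟫ := by
    refine (sq_le_sq₀ (by positivity) (by positivity)).1 ?_
    rw [mul_pow, Real.sq_sqrt (hnonneg _)]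
    exact hKorn _
  have hres : ⟪r + f, ι (u - v)⟫ ≤ ‖r + f‖ * (C * √⟪L (E (u - v)), E (u - v)⟫) :=
    (real_inner_le_norm _ _).trans (by gcongr)
  have hsq := Real.sq_sqrt (hnonneg (E (u - v)))
  rcases (Real.sqrt_nonneg ⟪L (E (u - v)), E (u - v)⟫).eq_or_lt with h0 | hpos
  · rw [← h0]
    positivity
  · refine le_of_mul_le_mul_right ?_ hpos
    linarith
end

section
/- Suppose u ∈ Q_e solves the coupled elasticity problem ⟨L(E u), E w⟩ = ⟨f − α₁ Λ₀ p₁ − α₂ Λ₀ p₂, ι w⟩ for all w ∈ Q_e, and suppose M ≥ 0 is a number bounding the pressure error in the sense that a_p := k₁‖Λ₀(p₁ − q₁)‖² + k₂‖Λ₀(p₂ − q₂)‖² + κ‖ι₀((p₁ − q₁) − (p₂ − q₂))‖² ≤ 2M. Then for every v ∈ Q_e, every τ ∈ Y_e and every r ∈ V with ⟨τ, E w⟩ = −⟨r, ι w⟩ for all w ∈ Q_e, and all β₃, β₄, β₅, β₆ > 0, the combined-norm estimate a_p + ⟨L(E(u − v)), E(u − v)⟩ ≤ (1 + β₄ + β₅)⟨L(E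 v − L' τ), E v − L' τ⟩ + (1 + 1/β₄ + β₆) C² ‖r + f − α₁ Λ₀ q₁ − α₂ Λ₀ q₂‖² + 2 Ĉ M holds, where Ĉ := 1 + C² (1 + 1/β₅ + 1/β₆) · max{ α₁²(1 + β₃)/k₁, α₂²(1 + β₃)/(k₂ β₃) }. -/
open RealInnerProductSpace

/-- Cauchy–Schwarz inequality for the semi-inner product induced by a symmetric positive
operator. -/
theorem inner_map_sq_le_mul {Y : Type*} [NormedAddCommGroup Y] [InnerProductSpace ℝ Y]
    (L : Y →L[ℝ] Y) (hsym : ∀ y z : Y, ⟪L y, z⟫ = ⟪y, L z⟫)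
    (hpos : ∀ y : Y, 0 ≤ ⟪L y, y⟫) (x y : Y) :
    ⟪L x, y⟫ ^ 2 ≤ ⟪L x, x⟫ * ⟪L y, y⟫ := by
  have key : ∀ t : ℝ, 0 ≤ ⟪L y, y⟫ * (t * t) + 2 * ⟪L x, y⟫ * t + ⟪L x, x⟫ := by
    intro t
    have h := hpos (x + t • y)
    have hyx : ⟪L y, x⟫ = ⟪L x, y⟫ := by rw [hsym, real_inner_comm]
    simp only [map_add, map_smul, inner_add_left, inner_add_right, real_inner_smul_left,
      real_inner_smul_right, hyx] at h
    linarith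
  have h := discrim_le_zero key
  unfold discrim at h
  linarith

/-- Weighted Young inequality for the square of a sum of two terms. -/
theorem add_sq_le_young {β : ℝ} (hβ : 0 < β) (a b : ℝ) :
    (a + b) ^ 2 ≤ (1 + β) * a ^ 2 + (1 + 1 / β) * b ^ 2 := by
  have h : (1 + β) * a ^ 2 + (1 + 1 / β) * b ^ 2 - (a + b) ^ 2 = (β * a - b) ^ 2 / β := by
    field_simp
    ring
  have : 0 ≤ (β * a - b) ^ 2 / β := by positivity
  linarith

/-- Weighted Young inequality for the square of a sum of three terms. -/
theorem add_add_sq_le_young {β γ δ : ℝ} (hβ : 0 < β) (hγ : 0 < γ) (hδ : 0 < δ) (a b c : ℝ) :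
    (a + b + c) ^ 2 ≤
      (1 + β + γ) * a ^ 2 + (1 + 1 / β + δ) * b ^ 2 + (1 + 1 / γ + 1 / δ) * c ^ 2 := by
  have h₁ := add_sq_le_young hβ a b
  have h₂ := add_sq_le_young hγ a c
  have h₃ := add_sq_le_young hδ b c
  linarith

/-- The squared norm of a sum of two scaled vectors is controlled by their weighted squared
norms. -/
theorem norm_smul_add_smul_sq_le {V : Type*} [NormedAddCommGroup V] [NormedSpace ℝ V]
    {k₁ k₂ β : ℝ} (hk₁ : 0 < k₁) (hk₂ : 0 < k₂) (hβ : 0 < β) (a b : ℝ) (x y : V) :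
    ‖a • x + b • y‖ ^ 2 ≤
      max (a ^ 2 * (1 + β) / k₁) (b ^ 2 * (1 + β) / (k₂ * β)) *
        (k₁ * ‖x‖ ^ 2 + k₂ * ‖y‖ ^ 2) := by
  have hnorm : ‖a • x + b • y‖ ^ 2 ≤ (‖a • x‖ + ‖b • y‖) ^ 2 := by
    gcongr
    exact norm_add_le _ _
  have hyoung := add_sq_le_young hβ ‖a • x‖ ‖b • y‖
  have h₁ : (1 + β) * ‖a • x‖ ^ 2 = a ^ 2 * (1 + β) / k₁ * (k₁ * ‖x‖ ^ 2) := by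
    rw [norm_smul, mul_pow, Real.norm_eq_abs, sq_abs]
    field_simp
  have h₂ : (1 + 1 / β) * ‖b • y‖ ^ 2 = b ^ 2 * (1 + β) / (k₂ * β) * (k₂ * ‖y‖ ^ 2) := by
    rw [norm_smul, mul_pow, Real.norm_eq_abs, sq_abs]
    field_simp
    ring
  calc ‖a • x + b • y‖ ^ 2
      ≤ a ^ 2 * (1 + β) / k₁ * (k₁ * ‖x‖ ^ 2) +
          b ^ 2 * (1 + β) / (k₂ * β) * (k₂ * ‖y‖ ^ 2) := by linarith
    _ ≤ _ := by
      rw [mul_add (max _ _)]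
      gcongr
      · exact le_max_left _ _
      · exact le_max_right _ _

theorem barenblatt_biot_combined_norm_estimate
    {P V H₀ Qe Ye : Type*}
    [NormedAddCommGroup P] [InnerProductSpace ℝ P]
    [NormedAddCommGroup V] [InnerProductSpace ℝ V]
    [NormedAddCommGroup H₀] [InnerProductSpace ℝ H₀]
    [NormedAddCommGroup Qe] [InnerProductSpace ℝ Qe]
    [NormedAddCommGroup Ye] [InnerProductSpace ℝ Ye]
    (Λ₀ : P →L[ℝ] V) (ι₀ : P →L[ℝ] H₀)
    (k₁ k₂ κ α₁ α₂ : ℝ)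
    (hk₁ : 0 < k₁) (hk₂ : 0 < k₂) (hκ : 0 < κ) (hα₁ : 0 < α₁) (hα₂ : 0 < α₂)
    (p₁ p₂ q₁ q₂ : P)
    (E : Qe →L[ℝ] Ye) (ι : Qe →L[ℝ] V)
    (L : Ye →L[ℝ] Ye) (hLsym : ∀ y z : Ye, ⟪L y, z⟫ = ⟪y, L z⟫)
    (α : ℝ) (hα : 0 < α) (hLcoer : ∀ y : Ye, α * ‖y‖ ^ 2 ≤ ⟪L y, y⟫)
    (L' : Ye →L[ℝ] Ye) (hLL' : ∀ y : Ye, L (L' y) = y) (hL'L : ∀ y : Ye, L' (L y) = y)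
    (C : ℝ) (hC : 0 < C)
    (hKorn : ∀ w : Qe, ‖ι w‖ ^ 2 ≤ C ^ 2 * ⟪L (E w), E w⟫)
    (f : V)
    (u : Qe)
    (hu : ∀ w : Qe,
      ⟪L (E u), E w⟫ = ⟪f - α₁ • Λ₀ p₁ - α₂ • Λ₀ p₂, ι w⟫)
    (M : ℝ) (hM : 0 ≤ M)
    (hpress :
      k₁ * ‖Λ₀ (p₁ - q₁)‖ ^ 2 + k₂ * ‖Λ₀ (p₂ - q₂)‖ ^ 2 +
        κ * ‖ι₀ ((p₁ - q₁) - (p₂ - q₂))‖ ^ 2 ≤ 2 * M)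
    (v : Qe) (τ : Ye) (r : V)
    (hτ : ∀ w : Qe, ⟪τ, E w⟫ = -⟪r, ι w⟫)
    (β₃ β₄ β₅ β₆ : ℝ) (hβ₃ : 0 < β₃) (hβ₄ : 0 < β₄) (hβ₅ : 0 < β₅) (hβ₆ : 0 < β₆) :
    k₁ * ‖Λ₀ (p₁ - q₁)‖ ^ 2 + k₂ * ‖Λ₀ (p₂ - q₂)‖ ^ 2 +
        κ * ‖ι₀ ((p₁ - q₁) - (p₂ - q₂))‖ ^ 2 +
      ⟪L (E (u - v)), E (u - v)⟫ ≤
      (1 + β₄ + β₅) * ⟪L (E v - L' τ), E v - L' τ⟫ +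
        (1 + 1 / β₄ + β₆) * C ^ 2 * ‖r + f - α₁ • Λ₀ q₁ - α₂ • Λ₀ q₂‖ ^ 2 +
        2 * (1 + C ^ 2 * (1 + 1 / β₅ + 1 / β₆) *
          max (α₁ ^ 2 * (1 + β₃) / k₁) (α₂ ^ 2 * (1 + β₃) / (k₂ * β₃))) * M := by
  have hpos : ∀ y : Ye, 0 ≤ ⟪L y, y⟫ := fun y => le_trans (by positivity) (hLcoer y)
  set e := u - v with he
  set d := E v - L' τ with hd
  set R := r + f - α₁ • Λ₀ q₁ - α₂ • Λ₀ q₂ with hR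
  set D := α₁ • Λ₀ (p₁ - q₁) + α₂ • Λ₀ (p₂ - q₂) with hD
  set m := max (α₁ ^ 2 * (1 + β₃) / k₁) (α₂ ^ 2 * (1 + β₃) / (k₂ * β₃))
  set s := √⟪L (E e), E e⟫
  set a := √⟪L d, d⟫
  have hs_sq : s ^ 2 = ⟪L (E e), E e⟫ := Real.sq_sqrt (hpos _)
  have ha_sq : a ^ 2 = ⟪L d, d⟫ := Real.sq_sqrt (hpos _)
  have hs_nonneg : 0 ≤ s := Real.sqrt_nonneg _
  have ha_nonneg : 0 ≤ a := Real.sqrt_nonneg _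
  have hsplit : ⟪L (E e), E e⟫ = ⟪R, ι e⟫ - ⟪D, ι e⟫ - ⟪L d, E e⟫ := by
    have hLe : L (E e) = L (E u) - τ - L d := by
      simp only [he, hd, map_sub, hLL']
      abel
    have hRD : R - D = r + (f - α₁ • Λ₀ p₁ - α₂ • Λ₀ p₂) := by
      simp only [hR, hD, map_sub, smul_sub]
      abel
    rw [← inner_sub_left, hRD, hLe, inner_sub_left, inner_sub_left, hu, hτ, inner_add_left]
    ring
  have hιe : ‖ι e‖ ≤ C * s := by
    refine le_of_sq_le_sq ?_ (by positivity)
    rw [mul_pow, hs_sq]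
    exact hKorn e
  have hRe : ⟪R, ι e⟫ ≤ ‖R‖ * (C * s) :=
    (real_inner_le_norm _ _).trans (by gcongr)
  have hDe : -⟪D, ι e⟫ ≤ ‖D‖ * (C * s) :=
    (neg_le_abs _).trans ((abs_real_inner_le_norm _ _).trans (by gcongr))
  have hde : -⟪L d, E e⟫ ≤ a * s := by
    refine (neg_le_abs _).trans (abs_le_of_sq_le_sq ?_ (by positivity))
    rw [mul_pow, ha_sq, hs_sq]
    exact inner_map_sq_le_mul L hLsym hpos d (E e)
  have hs_le : s ≤ a + C * ‖R‖ + C * ‖D‖ := by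
    rcases hs_nonneg.eq_or_lt with h | h
    · rw [← h]
      positivity
    · refine le_of_mul_le_mul_right ?_ h
      linarith
  have hstrain : ⟪L (E e), E e⟫ ≤ (1 + β₄ + β₅) * ⟪L d, d⟫ +
      (1 + 1 / β₄ + β₆) * C ^ 2 * ‖R‖ ^ 2 +
        C ^ 2 * (1 + 1 / β₅ + 1 / β₆) * ‖D‖ ^ 2 := by
    have h₁ : s ^ 2 ≤ (a + C * ‖R‖ + C * ‖D‖) ^ 2 := by gcongr
    have h₂ := add_add_sq_le_young hβ₄ hβ₅ hβ₆ a (C * ‖R‖) (C * ‖D‖)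
    rw [mul_pow, mul_pow, ha_sq] at h₂
    linarith
  have hD_le : ‖D‖ ^ 2 ≤ m * (2 * M) := by
    have hm_nonneg : 0 ≤ m := le_max_of_le_left (by positivity)
    have hcoupling : 0 ≤ κ * ‖ι₀ ((p₁ - q₁) - (p₂ - q₂))‖ ^ 2 := by positivity
    refine (norm_smul_add_smul_sq_le hk₁ hk₂ hβ₃ α₁ α₂ _ _).trans ?_
    gcongr
    linarith
  have hcD : C ^ 2 * (1 + 1 / β₅ + 1 / β₆) * ‖D‖ ^ 2 ≤
      C ^ 2 * (1 + 1 / β₅ + 1 / β₆) * (m * (2 * M)) := by gcongr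
  linarith
end
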